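/- Let a > 0 and r > 0 be real numbers and let n be a positive integer with cosh(a·r)² < n + 1. Then g_n(r) > 0, and for every x ∈ (0, r], every c ∈ [-1, 1] and every real H with H² ≤ a², one has (f_n'(x)·a·coth(a·x) - f_n''(x))·c² + 2·H·f_n'(x)·c + f_n'(x)·a·tanh(a·x) + f_n''(x) ≥ g_n(r). -/

import Mathlib

/-- The comparison function `f_k(x) = -(k/a)·(cosh(a·x))^(-1/k)`. -/
noncomputable def fcomp (a : ℝ) (k : ℕ) : ℝ → ℝ :=
  fun x => -((k : ℝ) / a) * Real.cosh (a * x) ^ (-(1 : ℝ) / (k : ℝ))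

/-- The function `g_k(x) = a·(k+1-cosh(a·x)²)/(k·(k+1)·(cosh(a·x))^((2k+1)/k))`. -/
noncomputable def gcomp (a : ℝ) (k : ℕ) : ℝ → ℝ :=
  fun x => a * ((k : ℝ) + 1 - Real.cosh (a * x) ^ 2) /
    ((k : ℝ) * ((k : ℝ) + 1) * Real.cosh (a * x) ^ ((2 * (k : ℝ) + 1) / (k : ℝ)))

theorem hasDerivAt_cosh_mul_rpow (a p x : ℝ) :
    HasDerivAt (fun y => Real.cosh (a * y) ^ p)
      (a * p * Real.cosh (a * x) ^ (p - 1) * Real.sinh (a * x)) x := by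
  have h : HasDerivAt (fun y => Real.cosh (a * y)) (Real.sinh (a * x) * a) x := by
    simpa using ((hasDerivAt_id x).const_mul a).cosh
  convert h.rpow_const (p := p) (Or.inl (Real.cosh_pos _).ne') using 1
  ring

theorem deriv_fcomp {a : ℝ} (ha : a ≠ 0) {n : ℕ} (hn : n ≠ 0) :
    deriv (fcomp a n) =
      fun x => Real.cosh (a * x) ^ (-(1 : ℝ) / n - 1) * Real.sinh (a * x) := by
  funext x
  refine ((hasDerivAt_cosh_mul_rpow a (-(1 : ℝ) / n) x).const_mul (-((n : ℝ) / a))).deriv.trans ?_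
  have : (n : ℝ) ≠ 0 := Nat.cast_ne_zero.mpr hn
  field_simp

theorem deriv_deriv_fcomp {a : ℝ} (ha : a ≠ 0) {n : ℕ} (hn : n ≠ 0) (x : ℝ) :
    deriv (deriv (fcomp a n)) x =
      a * (-(1 : ℝ) / n - 1) * Real.cosh (a * x) ^ (-(1 : ℝ) / n - 2) * Real.sinh (a * x) ^ 2
        + a * Real.cosh (a * x) ^ (-(1 : ℝ) / n - 1) * Real.cosh (a * x) := by
  rw [deriv_fcomp ha hn]
  have h : HasDerivAt (fun y => Real.sinh (a * y)) (Real.cosh (a * x) * a) x := by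
    simpa using ((hasDerivAt_id x).const_mul a).sinh
  refine ((hasDerivAt_cosh_mul_rpow a (-(1 : ℝ) / n - 1) x).mul h).deriv.trans ?_
  rw [show -(1 : ℝ) / n - 1 - 1 = -(1 : ℝ) / n - 2 by ring]
  ring

theorem gcomp_eq (a : ℝ) {n : ℕ} (hn : n ≠ 0) (x : ℝ) :
    gcomp a n x = a * Real.cosh (a * x) ^ (-(1 : ℝ) / n - 2) *
      (((n : ℝ) + 1 - Real.cosh (a * x) ^ 2) / ((n : ℝ) * ((n : ℝ) + 1))) := by
  have hn' : (n : ℝ) ≠ 0 := Nat.cast_ne_zero.mpr hn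
  have hexp : -(1 : ℝ) / n - 2 = -((2 * (n : ℝ) + 1) / n) := by field_simp; ring
  rw [gcomp, hexp, Real.rpow_neg (Real.cosh_pos _).le]
  have := (Real.rpow_pos_of_pos (Real.cosh_pos (a * x)) ((2 * (n : ℝ) + 1) / n)).ne'
  field_simp

/-- Completing the square in `c`. -/
theorem le_quadratic_of_sq_le_one {k S C c h : ℝ} (hk : 0 < k) (hh : h ^ 2 ≤ 1) :
    (k + 1 - C ^ 2) / (k * (k + 1)) ≤
      (k + 1) / k * S ^ 2 * c ^ 2 + 2 * h * S * C * c + ((k - 1) * C ^ 2 + 1) / k := by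
  have key : (k + 1) / k * S ^ 2 * c ^ 2 + 2 * h * S * C * c + ((k - 1) * C ^ 2 + 1) / k
      - (k + 1 - C ^ 2) / (k * (k + 1)) =
      (k + 1) / k * (S * c + h * C * k / (k + 1)) ^ 2 + C ^ 2 * k / (k + 1) * (1 - h ^ 2) := by
    field_simp
    ring
  have h1 : 0 ≤ (k + 1) / k * (S * c + h * C * k / (k + 1)) ^ 2 := by positivity
  have h2 : 0 ≤ C ^ 2 * k / (k + 1) * (1 - h ^ 2) :=
    mul_nonneg (by positivity) (by linarith)
  linarith

theorem gcomp_pos {a r : ℝ} (ha : 0 < a) {n : ℕ} (hn : 0 < n)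
    (hcosh : Real.cosh (a * r) ^ 2 < (n : ℝ) + 1) : 0 < gcomp a n r := by
  have : 0 < (n : ℝ) + 1 - Real.cosh (a * r) ^ 2 := by linarith
  have := Real.cosh_pos (a * r)
  unfold gcomp
  positivity

theorem gcomp_le_gcomp {a x r : ℝ} (ha : 0 < a) {n : ℕ} (hn : 0 < n) (hx : 0 ≤ x) (hxr : x ≤ r)
    (hcosh : Real.cosh (a * r) ^ 2 ≤ (n : ℝ) + 1) : gcomp a n r ≤ gcomp a n x := by
  have hle : Real.cosh (a * x) ≤ Real.cosh (a * r) := by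
    rw [Real.cosh_le_cosh, abs_of_nonneg (by positivity),
      abs_of_nonneg (mul_nonneg ha.le (hx.trans hxr))]
    gcongr
  have hC := Real.cosh_pos (a * x)
  have : 0 ≤ (n : ℝ) + 1 - Real.cosh (a * r) ^ 2 := by linarith
  have : Real.cosh (a * x) ^ 2 ≤ Real.cosh (a * r) ^ 2 := by gcongr
  have : 0 ≤ (n : ℝ) + 1 - Real.cosh (a * x) ^ 2 := by linarith
  unfold gcomp
  gcongr

theorem stmt_12 (a r : ℝ) (ha : 0 < a) (hr : 0 < r) (n : ℕ) (hn : 0 < n)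
    (hcosh : Real.cosh (a * r) ^ 2 < (n : ℝ) + 1) :
    0 < gcomp a n r ∧
    ∀ x ∈ Set.Ioc (0 : ℝ) r, ∀ c ∈ Set.Icc (-1 : ℝ) 1, ∀ H : ℝ, H ^ 2 ≤ a ^ 2 →
      (deriv (fcomp a n) x * (a * (Real.cosh (a * x) / Real.sinh (a * x)))
          - deriv (deriv (fcomp a n)) x) * c ^ 2
        + 2 * H * deriv (fcomp a n) x * c
        + deriv (fcomp a n) x * (a * Real.tanh (a * x))
        + deriv (deriv (fcomp a n)) x
      ≥ gcomp a n r := by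
  refine ⟨gcomp_pos ha hn hcosh, ?_⟩
  rintro x ⟨hx, hxr⟩ c - H hH
  refine ge_iff_le.mpr ((gcomp_le_gcomp ha hn hx.le hxr hcosh.le).trans ?_)
  rw [gcomp_eq a hn.ne', deriv_deriv_fcomp ha.ne' hn.ne', deriv_fcomp ha.ne' hn.ne',
    Real.tanh_eq_sinh_div_cosh]
  have hC := Real.cosh_pos (a * x)
  have hS : 0 < Real.sinh (a * x) := Real.sinh_pos_iff.mpr (by positivity)
  have hCS := Real.cosh_sq (a * x)
  have hpow : Real.cosh (a * x) ^ (-(1 : ℝ) / n - 1) =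
      Real.cosh (a * x) ^ (-(1 : ℝ) / n - 2) * Real.cosh (a * x) := by
    rw [← Real.rpow_add_one hC.ne']
    ring_nf
  have hP := Real.rpow_pos_of_pos hC (-(1 : ℝ) / n - 2)
  simp only [hpow]
  set C := Real.cosh (a * x)
  set S := Real.sinh (a * x)
  set P := C ^ (-(1 : ℝ) / n - 2)
  have hk : (0 : ℝ) < n := Nat.cast_pos.mpr hn
  have hh : (H / a) ^ 2 ≤ 1 := by
    rw [div_pow]
    exact div_le_one_of_le₀ hH (sq_nonneg a)
  refine (mul_le_mul_of_nonneg_left (le_quadratic_of_sq_le_one (S := S) (c := c) hk hh)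
    (mul_pos ha hP).le).trans_eq ?_
  field_simp
  linear_combination -a * hCS
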